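/- Let g : ℝ³ → [0,1] be a rotation-invariant mollifier, set χ := g*g, let h, ℓ > 0 be adapted to g, and fix 0 < q < 1/2 and β, d, D, δ, R, R′ > 0 with 0 < δ < d²/2 and q ≤ 1/2 − δ/d². Let φ ∈ H¹(ℝ³, ℝ) be a radial function such that the measure ρ₀ := φ(y)² dy is finite and nonzero, and assume there exists z₀ > 0 such that for every z ∈ ℝ³ with |z| ≤ z₀ the triple (ρ₀, ρ₀, (ρ₀)_z) is admissible, where (ρ₀)_z is the pushforward of ρ₀ under y ↦ y + z. Then, with H = (H₁, H₂, H₃) := H^χ_{q,ρ₀}, for all i, j ∈ {1,2,3}: −∫ H_j(y)·∂_{y_i}(φ(y)²) dy = δ_{ij}, i.e. −2⟨φ·H_j, ∂_{y_i}φ⟩_{L²} = δ_{ij}. -/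

import Mathlib

open MeasureTheory Measure Set Metric Filter
open scoped ENNReal NNReal RealInnerProductSpace BigOperators FourierTransform

noncomputable section

/-- Euclidean space `ℝ³`. -/
abbrev E3 := EuclideanSpace ℝ (Fin 3)

/-- A mollifier on `ℝ³`: a smooth, compactly supported, `[0,1]`-valued function with
integral one. -/
structure IsMollifier (χ : E3 → ℝ) : Prop where
  smooth : ContDiff ℝ (⊤ : ℕ∞) χ
  compactSupport : HasCompactSupport χ
  mem_Icc : ∀ y, χ y ∈ Set.Icc (0:ℝ) 1
  integral_one : (∫ y, χ y) = 1

/-- Rotation invariance of a function on `ℝ³`. -/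
def RotInv (g : E3 → ℝ) : Prop := ∀ x y : E3, ‖x‖ = ‖y‖ → g x = g y

/-- The `λ`-quantile `x^λ(ν) = sup {t : ν(-∞,t] ≤ λ·ν(ℝ)}` of a (finite Borel) measure on `ℝ`. -/
def quantile (ν : Measure ℝ) (lam : ℝ) : ℝ :=
  sSup {t : ℝ | (ν (Set.Iic t)).toReal ≤ lam * (ν Set.univ).toReal}

/-- The `j`-th marginal of a measure on `ℝ³`. -/
def marg (ρ : Measure E3) (j : Fin 3) : Measure ℝ := ρ.map (fun y => y j)

/-- The mollification `χ*ρ` of a measure `ρ` on `ℝ³`: the measure with Lebesgue density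
`x ↦ ∫ χ(x-y) dρ(y)`. -/
def mollify (χ : E3 → ℝ) (ρ : Measure E3) : Measure E3 :=
  volume.withDensity fun x => ENNReal.ofReal (∫ y, χ (x - y) ∂ρ)

/-- The `λ`-quantile `x^λ((χ*ρ)_j)` of the `j`-th marginal of the mollified measure. -/
def qtl (χ : E3 → ℝ) (ρ : Measure E3) (j : Fin 3) (lam : ℝ) : ℝ :=
  quantile (marg (mollify χ ρ) j) lam

/-- The function `f^χ_{j,t}(y) = ∫ χ(z)·1_{(-∞,t]}(y_j - z_j) dz`. -/
def fchi (χ : E3 → ℝ) (j : Fin 3) (t : ℝ) (y : E3) : ℝ :=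
  ∫ z, χ z * Set.indicator (Set.Iic t) (fun _ => (1:ℝ)) (y j - z j)

/-- The `j`-th standard basis vector of `ℝ³`. -/
def esingle (j : Fin 3) : E3 := EuclideanSpace.single j (1:ℝ)

/-- Constants `h, ℓ > 0` are adapted to `χ` if
`-∂_{y_j} f^χ_{j,t}(y) ≥ h·1_{(t-2ℓ,t+2ℓ)}(y_j)` for all `t, y, j`. -/
def Adapted (χ : E3 → ℝ) (h ℓ : ℝ) : Prop :=
  ∀ (j : Fin 3) (t : ℝ) (y : E3),
    h * Set.indicator (Set.Ioo (t - 2*ℓ) (t + 2*ℓ)) (fun _ => (1:ℝ)) (y j)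
      ≤ - fderiv ℝ (fchi χ j t) y (esingle j)

/-- Total variation distance `‖μ - ν‖_TV` of two finite measures. -/
def tv (μ ν : Measure E3) [IsFiniteMeasure μ] [IsFiniteMeasure ν] : ℝ :=
  ((μ.toSignedMeasure - ν.toSignedMeasure).totalVariation Set.univ).toReal

/-- Mollified total variation `‖g*(μ - ν)‖_TV`, i.e. the `L¹` norm of the difference of the
Lebesgue densities of `g*μ` and `g*ν`. -/
def tvMol (g : E3 → ℝ) (μ ν : Measure E3) : ℝ :=
  ∫ x, |(∫ y, g (x - y) ∂μ) - (∫ y, g (x - y) ∂ν)|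

/-- One component of the regularized median of a measure on `ℝ`:
the mean over the quantile window `[x^{1/2-q}, x^{1/2+q}]`. -/
def medComp (q : ℝ) (ν : Measure ℝ) : ℝ :=
  (∫ t in Set.Icc (quantile ν (1/2 - q)) (quantile ν (1/2 + q)), t ∂ν)
    / (ν (Set.Icc (quantile ν (1/2 - q)) (quantile ν (1/2 + q)))).toReal

/-- Assemble a vector of `ℝ³` from its coordinates. -/
def vec3 (f : Fin 3 → ℝ) : E3 := (EuclideanSpace.equiv (Fin 3) ℝ).symm f

/-- The regularized median `m_q(ρ) ∈ ℝ³` (componentwise over the marginals;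
by the junk-value conventions `m_q(0) = 0`). -/
def med (q : ℝ) (ρ : Measure E3) : E3 := vec3 fun j => medComp q (marg ρ j)

/-- The function `H^χ_{q,ρ₀} = (H₁,H₂,H₃) : ℝ³ → ℝ³` (componentwise). -/
def Hfun (χ : E3 → ℝ) (q : ℝ) (ρ₀ : Measure E3) (j : Fin 3) (y : E3) : ℝ :=
  (2 * q * (ρ₀ Set.univ).toReal)⁻¹ *
    ((∫ z, χ z *
        Set.indicator (Set.Icc (qtl χ ρ₀ j (1/2 - q)) (qtl χ ρ₀ j (1/2 + q)))
          (fun _ => (1:ℝ)) (y j - z j) *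
        (y j - z j - medComp q (marg (mollify χ ρ₀) j)))
      + (qtl χ ρ₀ j (1/2 + q) - medComp q (marg (mollify χ ρ₀) j))
          * (1/2 + q - fchi χ j (qtl χ ρ₀ j (1/2 + q)) y)
      + (medComp q (marg (mollify χ ρ₀) j) - qtl χ ρ₀ j (1/2 - q))
          * (1/2 - q - fchi χ j (qtl χ ρ₀ j (1/2 - q)) y))

/-- Mass and pair-correlation conditions `d ≤ ν(ℝ³) ≤ D`, `∬_{|x-y|>R} dν dν ≤ δ`. -/
def MassCond (d D δ R : ℝ) (ν : Measure E3) : Prop :=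
  d ≤ (ν Set.univ).toReal ∧ (ν Set.univ).toReal ≤ D ∧
    ((ν.prod ν) {p : E3 × E3 | R < dist p.1 p.2}).toReal ≤ δ

/-- Admissible triple `(ρ₀, ρ, ρ')` of measures on `ℝ³` (w.r.t. the mollifier `χ` and the
constants `q, ℓ, β, d, D, δ, R, R'`). -/
def Admissible (χ : E3 → ℝ) (q ℓ β d D δ R R' : ℝ) (ρ₀ ρ ρ' : Measure E3) : Prop :=
  (∃ qt : ℝ, 0 < qt ∧ qt ≤ q ∧
      ‖med qt ρ' - med qt ρ‖ + ‖med qt ρ - med qt ρ₀‖ ≤ R') ∧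
  MassCond d D δ R ρ₀ ∧ MassCond d D δ R ρ ∧ MassCond d D δ R ρ' ∧
  (∀ j : Fin 3,
    β ≤ (ρ₀ {y : E3 | |y j - qtl χ ρ₀ j (1/2 + q)| ≤ ℓ}).toReal ∧
    β ≤ (ρ₀ {y : E3 | |y j - qtl χ ρ₀ j (1/2 - q)| ≤ ℓ}).toReal)

/-- Convolution of two scalar functions on `ℝ³`. -/
def convFn (g₁ g₂ : E3 → ℝ) (x : E3) : ℝ := ∫ z, g₁ z * g₂ (x - z)

/-- Convolution of a scalar kernel with a vector-valued function on `ℝ³`. -/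
def convVec (k : E3 → ℝ) (F : E3 → E3) (y : E3) : E3 := ∫ z, k z • F (y - z)

/-- The boost function `𝓑(ρ) = m_q(χ*ρ) + ∫ f(y - m_q(χ*ρ)) dρ(y)`. -/
def Bfun (χ : E3 → ℝ) (q : ℝ) (f : E3 → E3) (ρ : Measure E3) : E3 :=
  med q (mollify χ ρ) + ∫ y, f (y - med q (mollify χ ρ)) ∂ρ

/-- `f ∈ C_b²(ℝ³,ℝ³)`: twice continuously differentiable with bounded derivatives
up to order two. -/
def CB2 (f : E3 → E3) : Prop :=
  ContDiff ℝ 2 f ∧ ∃ M : ℝ, ∀ y : E3,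
    ‖f y‖ ≤ M ∧ ‖fderiv ℝ f y‖ ≤ M ∧ ‖fderiv ℝ (fderiv ℝ f) y‖ ≤ M

/-- The polaron interaction `v(y) = π^{-3/2}|y|^{-2}`. -/
def vPol (y : E3) : ℝ := Real.pi ^ (-(3:ℝ)/2) * ‖y‖ ^ (-(2:ℝ))

/-- `h_ψ = |ψ|² * v`. -/
def hPek (ψ : E3 → ℂ) (x : E3) : ℝ := ∫ y, vPol (x - y) * ‖ψ y‖^2

/-- The Pekar energy
`𝓔(ψ,φ) = ‖φ‖² + ‖∇ψ‖² - 2∬ v(x-y)·Re φ(y)·|ψ(x)|² dx dy`. -/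
def PekarE (ψ φm : E3 → ℂ) : ℝ :=
  (∫ x, ‖φm x‖^2) + (∫ x, ‖fderiv ℝ ψ x‖^2)
    - 2 * ∫ pr : E3 × E3, vPol (pr.1 - pr.2) * (φm pr.2).re * ‖ψ pr.1‖^2
        ∂((volume : Measure E3).prod (volume : Measure E3))

/-- The Fourier transform of `v^Λ = χ(|∇| ≤ Λ)v`, namely
`k ↦ (2π)^{-1/2}|k|^{-1}·1_{|k| ≤ Λ}`. -/
def VLam (Λ : ℝ) (k : E3) : ℝ :=
  Set.indicator {k : E3 | ‖k‖ ≤ Λ} (fun k => (2 * Real.pi) ^ (-(1:ℝ)/2) * ‖k‖⁻¹) k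

/-- The Fourier transform of `w^Λ = (i∇/Δ)χ(|∇| > Λ)v`, namely
`k ↦ (2π)^{-1/2}|k|^{-3}·k·1_{|k| > Λ}`. -/
def WLam (Λ : ℝ) (k : E3) : E3 :=
  Set.indicator {k : E3 | Λ < ‖k‖} (fun k => ((2 * Real.pi) ^ (-(1:ℝ)/2) * (‖k‖^3)⁻¹) • k) k

/-- Pair correlation functional `∬_{|x-y| > R*} dρ(x) dρ(y)`. -/
def pairF (Rstar : ℝ) (ρ : Measure E3) : ℝ :=
  ((ρ.prod ρ) {p : E3 × E3 | Rstar < dist p.1 p.2}).toReal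

/-- The smooth cut-off functional
`F(ρ) = β₁(((ρ(ℝ³)-a)² + (∬_{|x-y|>R*}dρdρ - δ*)² - σ²)/κ²)`. -/
def Fcut (a Rstar δstar κ σ : ℝ) (β₁ : ℝ → ℝ) (ρ : Measure E3) : ℝ :=
  β₁ ((((ρ Set.univ).toReal - a)^2 + (pairF Rstar ρ - δstar)^2 - σ^2) / κ^2)


theorem continuous_measure_Iic_toReal (ν : Measure ℝ) [IsFiniteMeasure ν] [NullSingletonClass ν] :
    Continuous fun t => (ν (Iic t)).toReal := by
  have key : (fun t => (ν (Iic t)).toReal)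
      = fun t => ∫ x, (Iic t).indicator (fun _ => (1:ℝ)) x ∂ν := by
    funext t
    rw [integral_indicator measurableSet_Iic]
    simp [Measure.real]
  rw [key, continuous_iff_continuousAt]
  intro t₀
  refine continuousAt_of_dominated (bound := fun _ => 1)
    (Eventually.of_forall fun t => ?_) (Eventually.of_forall fun t => ae_of_all _ fun x => ?_)
    (integrable_const _) ?_
  · exact (measurable_const.indicator measurableSet_Iic).aestronglyMeasurable
  · by_cases hx : x ∈ Iic t <;> simp [hx]
  · have : ∀ᵐ x ∂ν, x ≠ t₀ := by simp [ae_iff]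
    filter_upwards [this] with x hx
    rcases lt_or_gt_of_ne hx with hx | hx
    · refine (continuousAt_const (y := (1:ℝ))).congr ?_
      filter_upwards [lt_mem_nhds hx] with t ht
      simp [ht.le]
    · refine (continuousAt_const (y := (0:ℝ))).congr ?_
      filter_upwards [gt_mem_nhds hx] with t ht
      simp [ht]

section Quantile

variable (ν : Measure ℝ) [IsFiniteMeasure ν]

theorem quantile_set_nonempty (hν : 0 < (ν univ).toReal) {lam : ℝ} (h0 : 0 < lam) :
    {t : ℝ | (ν (Iic t)).toReal ≤ lam * (ν univ).toReal}.Nonempty := by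
  have h' := tendsto_measure_iInter_atBot (μ := ν) (s := fun t : ℝ => Iic t)
    (fun t => measurableSet_Iic.nullMeasurableSet) monotone_Iic ⟨0, by finiteness⟩
  have he : ⋂ t : ℝ, Iic t = ∅ := by
    simpa using iInter_Iic_eq_empty_iff (f := fun t : ℝ => t)
  rw [he, measure_empty] at h'
  have h := (ENNReal.tendsto_toReal ENNReal.zero_ne_top).comp h'
  exact ((h.eventually_lt_const (by simpa using mul_pos h0 hν)).mono
    fun t ht => le_of_lt ht).exists

theorem quantile_set_bddAbove (hν : 0 < (ν univ).toReal) {lam : ℝ} (h1 : lam < 1) :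
    BddAbove {t : ℝ | (ν (Iic t)).toReal ≤ lam * (ν univ).toReal} := by
  have h := (ENNReal.tendsto_toReal (by finiteness)).comp (tendsto_measure_Iic_atTop ν)
  obtain ⟨T, hT⟩ := (h.eventually_const_lt (mul_lt_of_lt_one_left hν h1)).exists
  refine ⟨T, fun t ht => ?_⟩
  by_contra! hlt
  have : (ν (Iic T)).toReal ≤ (ν (Iic t)).toReal :=
    ENNReal.toReal_mono (by finiteness) (measure_mono (Iic_subset_Iic.2 hlt.le))
  exact absurd (this.trans ht) (not_le.2 hT)

theorem quantile_le_quantile (hν : 0 < (ν univ).toReal) {a b : ℝ} (ha : 0 < a) (hb : b < 1)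
    (hab : a ≤ b) : quantile ν a ≤ quantile ν b :=
  csSup_le_csSup (quantile_set_bddAbove ν hν hb) (quantile_set_nonempty ν hν ha)
    fun _ ht => le_trans ht (mul_le_mul_of_nonneg_right hab hν.le)

theorem measure_Iic_quantile [NullSingletonClass ν] (hν : 0 < (ν univ).toReal) {lam : ℝ} (h0 : 0 < lam)
    (h1 : lam < 1) : (ν (Iic (quantile ν lam))).toReal = lam * (ν univ).toReal := by
  have hc := continuous_measure_Iic_toReal ν
  have hb := quantile_set_bddAbove ν hν h1
  refine le_antisymm ((isClosed_le hc continuous_const).csSup_mem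
    (quantile_set_nonempty ν hν h0) hb) ?_
  by_contra! hlt
  have hev := hc.continuousAt.eventually_lt_const hlt
  obtain ⟨t, ht, htq⟩ := ((hev.filter_mono nhdsWithin_le_nhds).and
    (self_mem_nhdsWithin (s := Ioi (quantile ν lam)))).exists
  exact absurd (le_csSup hb (le_of_lt ht)) (not_le.2 htq)

theorem measure_Icc_quantile [NullSingletonClass ν] (hν : 0 < (ν univ).toReal) {a b : ℝ} (ha : 0 < a)
    (hb : b < 1) (hab : a ≤ b) :
    (ν (Icc (quantile ν a) (quantile ν b))).toReal = (b - a) * (ν univ).toReal := by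
  have hle := quantile_le_quantile ν hν ha hb hab
  rw [← measure_congr Ioc_ae_eq_Icc, ← Iic_sdiff_Iic,
    measure_sdiff (Iic_subset_Iic.2 hle) measurableSet_Iic.nullMeasurableSet (by finiteness),
    ENNReal.toReal_sub_of_le (measure_mono (Iic_subset_Iic.2 hle)) (by finiteness),
    measure_Iic_quantile ν hν (ha.trans_le hab) hb,
    measure_Iic_quantile ν hν ha (hab.trans_lt hb)]
  ring

end Quantile

theorem ae_coord_ne (j : Fin 3) (c : ℝ) : ∀ᵐ z : E3, z j ≠ c := by
  have h0 : (volume : Measure (Fin 3 → ℝ)) {f | f j = c} = 0 := by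
    rw [volume_pi]
    exact Measure.pi_hyperplane (fun _ : Fin 3 => (volume : Measure ℝ)) j c
  have h := (PiLp.volume_preserving_ofLp (Fin 3)).measure_preimage
    (measurableSet_eq_fun (measurable_pi_apply j) measurable_const).nullMeasurableSet
    (s := {f : Fin 3 → ℝ | f j = c})
  rw [h0] at h
  rw [ae_iff]
  simpa using h

@[fun_prop]
theorem measurable_coord (j : Fin 3) : Measurable fun y : E3 => y j := by fun_prop

theorem nullSingletonClass_marg_mollify (χ : E3 → ℝ) (ρ : Measure E3) (j : Fin 3) :
    NullSingletonClass (marg (mollify χ ρ) j) where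
  measure_singleton c := by
    rw [marg, Measure.map_apply (measurable_coord j) (measurableSet_singleton c)]
    refine withDensity_absolutelyContinuous _ _ ?_
    simpa [ae_iff] using! ae_coord_ne j c

/-- The truncation of the identity to `[a, b]`. -/
def truncId (a b s : ℝ) : ℝ := max a (min b s)

theorem abs_truncId_le (a b s : ℝ) : |truncId a b s| ≤ |a| + |b| := by
  unfold truncId
  rcases max_cases a (min b s) with h | h <;> rcases min_cases b s with h' | h' <;>
    rw [abs_le] <;> constructor <;>
    linarith [abs_nonneg a, abs_nonneg b, neg_abs_le a, neg_abs_le b, le_abs_self a, le_abs_self b]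

theorem lipschitzWith_truncId (a b : ℝ) : LipschitzWith 1 (truncId a b) :=
  (LipschitzWith.id.const_min b).const_max a

theorem hasDerivAt_truncId {a b s : ℝ} (ha : s ≠ a) (hb : s ≠ b) (hab : a ≤ b) :
    HasDerivAt (truncId a b) ((Icc a b).indicator (fun _ => (1:ℝ)) s) s := by
  unfold truncId
  rcases lt_or_gt_of_ne ha with ha | ha
  · rw [indicator_of_notMem (by simp [ha])]
    refine (hasDerivAt_const s a).congr_of_eventuallyEq ?_
    filter_upwards [gt_mem_nhds ha] with t ht
    rw [max_eq_left ((min_le_right _ _).trans ht.le)]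
  rcases lt_or_gt_of_ne hb with hb | hb
  · rw [indicator_of_mem (show s ∈ Icc a b from ⟨ha.le, hb.le⟩)]
    refine (hasDerivAt_id s).congr_of_eventuallyEq ?_
    filter_upwards [gt_mem_nhds hb, lt_mem_nhds ha] with t ht ht'
    rw [min_eq_right ht.le, max_eq_right ht'.le, id]
  · rw [indicator_of_notMem (by simp [hb])]
    refine (hasDerivAt_const s b).congr_of_eventuallyEq ?_
    filter_upwards [lt_mem_nhds hb] with t ht
    rw [min_eq_left ht.le, max_eq_right hab]

/-- A probability density on `ℝ³` that is bounded by one and even. -/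
structure IsEvenKernel (χ : E3 → ℝ) : Prop where
  continuous : Continuous χ
  nonneg : ∀ y, 0 ≤ χ y
  le_one : ∀ y, χ y ≤ 1
  integrable : Integrable χ
  integral_one : (∫ y, χ y) = 1
  even : ∀ y, χ (-y) = χ y

theorem IsMollifier.isEvenKernel_convFn {g : E3 → ℝ} (hg : IsMollifier g) (hrot : RotInv g) :
    IsEvenKernel (convFn g g) := by
  have hgc : Continuous g := hg.smooth.continuous
  have hgi : Integrable g := hgc.integrable_of_hasCompactSupport hg.compactSupport
  have heven : ∀ y, g (-y) = g y := fun y => hrot _ _ (norm_neg y)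
  have hconv : convFn g g = convolution g g (ContinuousLinearMap.mul ℝ ℝ) volume := rfl
  have hint : ∀ x, Integrable fun z => g z * g (x - z) := fun x =>
    hgi.mul_bdd (c := 1) (by fun_prop) (ae_of_all _ fun z => by
      rw [Real.norm_of_nonneg (hg.mem_Icc _).1]; exact (hg.mem_Icc _).2)
  refine ⟨?_, fun y => ?_, fun y => ?_, ?_, ?_, fun y => ?_⟩
  · rw [hconv]
    exact hg.compactSupport.continuous_convolution_right _ hgc.locallyIntegrable hgc
  · exact integral_nonneg fun z => mul_nonneg (hg.mem_Icc _).1 (hg.mem_Icc _).1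
  · rw [← hg.integral_one]
    exact integral_mono (hint y) hgi fun z =>
      mul_le_of_le_one_right (hg.mem_Icc _).1 (hg.mem_Icc _).2
  · rw [hconv]
    exact hgi.integrable_convolution _ hgi
  · rw [hconv, integral_convolution _ hgi hgi, hg.integral_one]
    simp
  · unfold convFn
    rw [← integral_neg_eq_self]
    refine integral_congr_ae (ae_of_all _ fun z => ?_)
    simp only
    rw [heven z, ← heven (-y - -z)]
    congr 2
    abel

namespace IsEvenKernel

variable {χ : E3 → ℝ}

theorem integrable_sub_prod (hχ : IsEvenKernel χ) (ρ : Measure E3) [IsFiniteMeasure ρ] :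
    Integrable (fun p : E3 × E3 => χ (p.1 - p.2)) (volume.prod ρ) := by
  have hc := hχ.continuous
  rw [integrable_prod_iff' (by fun_prop)]
  refine ⟨ae_of_all _ fun y => hχ.integrable.comp_sub_right y, ?_⟩
  refine (integrable_const (1:ℝ)).congr (ae_of_all _ fun y => ?_)
  simp only [Real.norm_of_nonneg (hχ.nonneg _)]
  rw [integral_sub_right_eq_self χ y, hχ.integral_one]

theorem isFiniteMeasure_mollify (hχ : IsEvenKernel χ) (ρ : Measure E3) [IsFiniteMeasure ρ] :
    IsFiniteMeasure (mollify χ ρ) :=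
  isFiniteMeasure_withDensity_ofReal (hχ.integrable_sub_prod ρ).integral_prod_left.2

theorem marg_mollify_apply (hχ : IsEvenKernel χ) (ρ : Measure E3) [IsFiniteMeasure ρ] (j : Fin 3)
    {A : Set ℝ} (hA : MeasurableSet A) :
    (marg (mollify χ ρ) j A).toReal
      = ∫ y, (∫ z, χ z * A.indicator (fun _ => (1:ℝ)) (y j - z j)) ∂ρ := by
  have hm : MeasurableSet ((fun y : E3 => y j) ⁻¹' A) := measurable_coord j hA
  have hint := hχ.integrable_sub_prod ρ
  have hind : Measurable fun p : E3 × E3 => A.indicator (fun _ => (1:ℝ)) (p.1 j) :=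
    (measurable_const.indicator hA).comp ((measurable_coord j).comp measurable_fst)
  have hint' : Integrable (fun p : E3 × E3 =>
      χ (p.1 - p.2) * A.indicator (fun _ => (1:ℝ)) (p.1 j)) (volume.prod ρ) := by
    refine hint.mul_bdd (c := 1) hind.aestronglyMeasurable (ae_of_all _ fun p => ?_)
    by_cases hp : p.1 j ∈ A <;> simp [hp]
  rw [marg, Measure.map_apply (measurable_coord j) hA, mollify, withDensity_apply _ hm,
    ← integral_eq_lintegral_of_nonneg_ae
      (ae_of_all _ fun x => integral_nonneg fun y => hχ.nonneg _)
      hint.integral_prod_left.aestronglyMeasurable.restrict,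
    ← integral_indicator hm]
  calc _ = ∫ x, ∫ y, χ (x - y) * A.indicator (fun _ => (1:ℝ)) (x j) ∂ρ := by
        refine integral_congr_ae (ae_of_all _ fun x => ?_)
        by_cases hx : x j ∈ A <;> simp [hx]
    _ = ∫ y, (∫ x, χ (x - y) * A.indicator (fun _ => (1:ℝ)) (x j)) ∂ρ :=
        integral_integral_swap hint'
    _ = _ := by
        refine integral_congr_ae (ae_of_all _ fun y => ?_)
        simp only
        rw [← integral_sub_left_eq_self _ _ y]
        refine integral_congr_ae (ae_of_all _ fun z => ?_)
        simp [hχ.even]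

theorem marg_mollify_univ (hχ : IsEvenKernel χ) (ρ : Measure E3) [IsFiniteMeasure ρ] (j : Fin 3) :
    (marg (mollify χ ρ) j univ).toReal = (ρ univ).toReal := by
  rw [hχ.marg_mollify_apply ρ j MeasurableSet.univ]
  simp [hχ.integral_one, Measure.real]

theorem integrable_mul_truncId (hχ : IsEvenKernel χ) (j : Fin 3) (a b s : ℝ) :
    Integrable fun z : E3 => χ z * truncId a b (s - z j) :=
  hχ.integrable.mul_bdd (c := |a| + |b|)
    ((lipschitzWith_truncId a b).continuous.measurable.comp
      (by fun_prop)).aestronglyMeasurable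
    (ae_of_all _ fun _ => abs_truncId_le _ _ _)

theorem integrable_mul_indicator (hχ : IsEvenKernel χ) (j : Fin 3) {A : Set ℝ}
    (hA : MeasurableSet A) (s : ℝ) :
    Integrable fun z : E3 => χ z * A.indicator (fun _ => (1:ℝ)) (s - z j) := by
  refine hχ.integrable.mul_bdd (c := 1)
    ((measurable_const.indicator hA).comp (by fun_prop)).aestronglyMeasurable
    (ae_of_all _ fun z => ?_)
  by_cases hz : s - z j ∈ A <;> simp [hz]

theorem abs_integral_mul_truncId_le (hχ : IsEvenKernel χ) (j : Fin 3) (a b s : ℝ) :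
    |∫ z, χ z * truncId a b (s - z j)| ≤ |a| + |b| := by
  refine (abs_integral_le_integral_abs).trans ?_
  calc _ ≤ ∫ z, χ z * (|a| + |b|) := by
        refine integral_mono (hχ.integrable_mul_truncId j a b s).abs
          (hχ.integrable.mul_const _) fun z => ?_
        simp only [abs_mul, abs_of_nonneg (hχ.nonneg z)]
        exact mul_le_mul_of_nonneg_left (abs_truncId_le _ _ _) (hχ.nonneg z)
    _ = _ := by rw [integral_mul_const, hχ.integral_one, one_mul]

theorem abs_integral_mul_indicator_le (hχ : IsEvenKernel χ) (j : Fin 3) {A : Set ℝ}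
    (hA : MeasurableSet A) (s : ℝ) :
    |∫ z, χ z * A.indicator (fun _ => (1:ℝ)) (s - z j)| ≤ 1 := by
  have hnn : ∀ z : E3, 0 ≤ A.indicator (fun _ => (1:ℝ)) (s - z j) := fun z =>
    indicator_nonneg (fun _ _ => zero_le_one) _
  rw [abs_of_nonneg (integral_nonneg fun z : E3 => mul_nonneg (hχ.nonneg z) (hnn z))]
  refine le_of_le_of_eq ?_ hχ.integral_one
  exact integral_mono (hχ.integrable_mul_indicator j hA s) hχ.integrable fun z =>
    mul_le_of_le_one_right (hχ.nonneg z)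
      (indicator_apply_le' (fun _ => le_rfl) fun _ => zero_le_one)

theorem hasDerivAt_integral_truncId (hχ : IsEvenKernel χ) (j : Fin 3) {a b : ℝ} (hab : a ≤ b)
    (s : ℝ) :
    HasDerivAt (fun s => ∫ z, χ z * truncId a b (s - z j))
      (∫ z, χ z * (Icc a b).indicator (fun _ => (1:ℝ)) (s - z j)) s := by
  refine (hasDerivAt_integral_of_dominated_loc_of_lip (s := univ) (bound := χ) univ_mem
    (Eventually.of_forall fun t => (hχ.integrable_mul_truncId j a b t).aestronglyMeasurable)
    (hχ.integrable_mul_truncId j a b s)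
    (hχ.integrable_mul_indicator j measurableSet_Icc s).aestronglyMeasurable
    (ae_of_all _ fun z => ?_) hχ.integrable ?_).2
  · refine (LipschitzWith.of_dist_le_mul fun t u => ?_).lipschitzOnWith
    rw [Real.dist_eq, ← mul_sub, abs_mul, Real.coe_nnabs]
    refine mul_le_mul_of_nonneg_left ?_ (abs_nonneg _)
    have := (lipschitzWith_truncId a b).dist_le_mul (t - z j) (u - z j)
    simpa [Real.dist_eq] using this
  · filter_upwards [ae_coord_ne j (s - a), ae_coord_ne j (s - b)] with z ha hb
    have h := hasDerivAt_truncId (s := s - z j) (fun h => ha (by linarith))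
      (fun h => hb (by linarith)) hab
    exact (h.comp_sub_const s (z j)).const_mul (χ z)

theorem Hfun_eq (hχ : IsEvenKernel χ) {q : ℝ} {ρ : Measure E3} {j : Fin 3} {a b m : ℝ}
    (ha : qtl χ ρ j (1/2 - q) = a) (hb : qtl χ ρ j (1/2 + q) = b)
    (hm : medComp q (marg (mollify χ ρ) j) = m) (hab : a ≤ b) (y : E3) :
    Hfun χ q ρ j y = (2 * q * (ρ univ).toReal)⁻¹ *
      ((∫ z, χ z * truncId a b (y j - z j)) + ((a + b - 2 * m) * (q - 1/2) - m)) := by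
  have hT := hχ.integrable_mul_truncId j a b (y j)
  have hA := hχ.integrable_mul_indicator j (measurableSet_Iic (a := a)) (y j)
  have hB := hχ.integrable_mul_indicator j (measurableSet_Iic (a := b)) (y j)
  have key : (∫ z, χ z * (Icc a b).indicator (fun _ => (1:ℝ)) (y j - z j) * (y j - z j - m))
      = (∫ z, χ z * truncId a b (y j - z j)) - b + (b - m) * fchi χ j b y
        - (a - m) * fchi χ j a y := by
    unfold fchi
    calc _ = ∫ z, (χ z * truncId a b (y j - z j) - χ z * b
          + (b - m) * (χ z * (Iic b).indicator (fun _ => (1:ℝ)) (y j - z j))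
          - (a - m) * (χ z * (Iic a).indicator (fun _ => (1:ℝ)) (y j - z j))) := by
          refine integral_congr_ae ?_
          filter_upwards [ae_coord_ne j (y j - a)] with z hz
          have hz' : y j - z j ≠ a := fun h => hz (by linarith)
          generalize y j - z j = s at hz' ⊢
          rcases lt_or_gt_of_ne hz' with h1 | h1
          · have h2 : s ≤ b := h1.le.trans hab
            simp only [indicator, mem_Icc, mem_Iic, h1.le, h2, h1.not_ge, truncId, min_eq_right h2,
              max_eq_left h1.le, if_true, false_and, if_false]
            ring
          · rcases le_or_gt s b with h2 | h2
            · simp only [indicator, mem_Icc, mem_Iic, h1.le, h2, h1.not_ge, truncId,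
                min_eq_right h2, max_eq_right h1.le, if_true, and_self, if_false]
              ring
            · simp only [indicator, mem_Icc, mem_Iic, h2.not_ge, h1.not_ge, truncId,
                min_eq_left h2.le, max_eq_right hab, and_false, if_false]
              ring
      _ = _ := by
          have h1 : Integrable fun z : E3 => χ z * truncId a b (y j - z j) - χ z * b :=
            hT.sub (hχ.integrable.mul_const b)
          have h2 : Integrable fun z : E3 => χ z * truncId a b (y j - z j) - χ z * b
              + (b - m) * (χ z * (Iic b).indicator (fun _ => (1:ℝ)) (y j - z j)) :=
            h1.add (hB.const_mul _)
          rw [integral_sub h2 (hA.const_mul _), integral_add h1 (hB.const_mul _),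
            integral_sub hT (hχ.integrable.mul_const b), integral_const_mul, integral_const_mul,
            integral_mul_const, hχ.integral_one, one_mul]
  rw [Hfun, ha, hb, hm, key]
  ring

end IsEvenKernel

theorem coord_add_smul_esingle (x : E3) (i j : Fin 3) (t : ℝ) :
    (x + t • esingle i) j = x j + t * (if i = j then 1 else 0) := by
  simp [esingle, eq_comm]

theorem integrable_mul_fderiv_apply {φ : E3 → ℝ} (hφ : Differentiable ℝ φ)
    (hφL2 : Integrable fun y => (φ y) ^ 2) (hφgrad : Integrable fun y => ‖fderiv ℝ φ y‖ ^ 2)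
    (v : E3) : Integrable fun y => φ y * fderiv ℝ φ y v := by
  have hm : Measurable fun y => fderiv ℝ φ y v := measurable_fderiv_apply_const ℝ φ v
  refine (hφL2.add (hφgrad.mul_const (‖v‖ ^ 2))).mono'
    (hφ.continuous.measurable.mul hm).aestronglyMeasurable (ae_of_all _ fun y => ?_)
  have hle := (fderiv ℝ φ y).le_opNorm v
  have hsq : ‖fderiv ℝ φ y v‖ ^ 2 ≤ ‖fderiv ℝ φ y‖ ^ 2 * ‖v‖ ^ 2 := by
    rw [← mul_pow]
    exact pow_le_pow_left₀ (norm_nonneg _) hle 2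
  simp only [norm_mul, Pi.add_apply]
  have h1 : ‖φ y‖ ^ 2 = φ y ^ 2 := by simp
  nlinarith [sq_nonneg (‖φ y‖ - ‖fderiv ℝ φ y v‖), sq_nonneg (φ y),
    sq_nonneg ‖fderiv ℝ φ y v‖]

/-- Integration by parts against the translation-covariant function `Hfun`. -/
theorem neg_integral_Hfun_mul_fderiv_sq {χ : E3 → ℝ} (hχ : IsEvenKernel χ) {q : ℝ} (hq0 : 0 < q)
    (hq : q < 1/2) {φ : E3 → ℝ} (hφ : Differentiable ℝ φ)
    (hφL2 : Integrable fun y => (φ y) ^ 2) (hφgrad : Integrable fun y => ‖fderiv ℝ φ y‖ ^ 2)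
    {ρ : Measure E3} [IsFiniteMeasure ρ]
    (hρ : ρ = volume.withDensity fun y => ENNReal.ofReal ((φ y) ^ 2)) (hρ0 : ρ ≠ 0)
    (i j : Fin 3) :
    -∫ y, Hfun χ q ρ j y * (2 * (φ y * fderiv ℝ φ y (esingle i)))
      = if i = j then (1:ℝ) else 0 := by
  have hM : 0 < (ρ univ).toReal :=
    ENNReal.toReal_pos (by simpa using hρ0) (by finiteness)
  have := hχ.isFiniteMeasure_mollify ρ
  have : IsFiniteMeasure (marg (mollify χ ρ) j) := by unfold marg; infer_instance
  have := nullSingletonClass_marg_mollify χ ρ j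
  have hN := hχ.marg_mollify_univ ρ j
  have hN0 : 0 < (marg (mollify χ ρ) j univ).toReal := hN ▸ hM
  have hmass := measure_Icc_quantile _ hN0 (a := 1/2 - q) (b := 1/2 + q) (by linarith)
    (by linarith) (by linarith)
  have hab : qtl χ ρ j (1/2 - q) ≤ qtl χ ρ j (1/2 + q) :=
    quantile_le_quantile _ hN0 (by linarith) (by linarith) (by linarith)
  change (marg (mollify χ ρ) j (Icc (qtl χ ρ j (1/2 - q)) (qtl χ ρ j (1/2 + q)))).toReal = _
    at hmass
  have hH := hχ.Hfun_eq (q := q) (ρ := ρ) (j := j) rfl rfl rfl hab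
  rw [hN, hχ.marg_mollify_apply ρ j measurableSet_Icc] at hmass
  generalize qtl χ ρ j (1/2 - q) = a at *
  generalize qtl χ ρ j (1/2 + q) = b at *
  generalize (a + b - 2 * medComp q (marg (mollify χ ρ) j)) * (q - 1/2)
    - medComp q (marg (mollify χ ρ) j) = c at hH
  set C := (2 * q * (ρ univ).toReal)⁻¹ with hC
  set P : ℝ := if i = j then 1 else 0 with hP
  set T : ℝ → ℝ := fun s => ∫ z, χ z * truncId a b (s - z j) with hT
  set K : ℝ → ℝ := fun s => ∫ z, χ z * (Icc a b).indicator (fun _ => (1:ℝ)) (s - z j) with hK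
  have hTK : ∀ s, HasDerivAt T (K s) s := hχ.hasDerivAt_integral_truncId j hab
  have hTm : Measurable T := (show Differentiable ℝ T from
    fun s => (hTK s).differentiableAt).continuous.measurable
  have hKm : Measurable K := by
    rw [show K = deriv T from funext fun s => (hTK s).deriv.symm]
    exact measurable_deriv T
  have hHfun : Hfun χ q ρ j = fun y => C * (T (y j) + c) := funext hH
  have hHder : ∀ y, HasLineDerivAt ℝ (Hfun χ q ρ j) (C * (K (y j) * P)) y (esingle i) := by
    intro y
    rw [hHfun]
    unfold HasLineDerivAt
    simp only [coord_add_smul_esingle]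
    have hin : HasDerivAt (fun t : ℝ => y j + t * P) P 0 := by
      simpa using ((hasDerivAt_id (0:ℝ)).mul_const P).const_add (y j)
    have hT0 : HasDerivAt T (K (y j)) (y j + 0 * P) := by simpa using hTK (y j)
    exact ((hT0.comp (0:ℝ) hin).add_const c).const_mul C
  have hφder : ∀ y, HasLineDerivAt ℝ (fun y => (φ y) ^ 2)
      (2 * (φ y * fderiv ℝ φ y (esingle i))) y (esingle i) := by
    intro y
    have h := ((hφ y).hasFDerivAt.pow 2).hasLineDerivAt (esingle i)
    have hv : ((2 • φ y ^ (2 - 1)) • fderiv ℝ φ y) (esingle i)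
        = 2 * (φ y * fderiv ℝ φ y (esingle i)) := by
      simp [mul_assoc]
    rwa [hv] at h
  have hHm : Measurable (Hfun χ q ρ j) := by
    rw [hHfun]
    exact ((hTm.comp (measurable_coord j)).add_const c).const_mul C
  have hHb : ∀ y, ‖Hfun χ q ρ j y‖ ≤ |C| * (|a| + |b| + |c|) := by
    intro y
    rw [hHfun, Real.norm_eq_abs, abs_mul]
    exact mul_le_mul_of_nonneg_left ((abs_add_le _ _).trans
      (add_le_add_left (hχ.abs_integral_mul_truncId_le j a b (y j)) _)) (abs_nonneg _)
  have hφφ := (integrable_mul_fderiv_apply hφ hφL2 hφgrad (esingle i)).const_mul 2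
  have hKφ : Integrable fun y : E3 => K (y j) * φ y ^ 2 :=
    hφL2.bdd_mul (c := 1) (hKm.comp (measurable_coord j)).aestronglyMeasurable
      (ae_of_all _ fun y => hχ.abs_integral_mul_indicator_le j measurableSet_Icc (y j))
  have hibp := integral_bilinear_hasLineDerivAt_right_eq_neg_left_of_integrable
    (μ := (volume : Measure E3)) (B := ContinuousLinearMap.mul ℝ ℝ)
    (f := Hfun χ q ρ j) (f' := fun y => C * (K (y j) * P)) (g := fun y => (φ y) ^ 2)
    (g' := fun y => 2 * (φ y * fderiv ℝ φ y (esingle i))) (v := esingle i)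
    ((hKφ.const_mul (C * P)).congr (ae_of_all _ fun y => by simp; ring))
    (hφφ.bdd_mul hHm.aestronglyMeasurable (ae_of_all _ hHb))
    (hφL2.bdd_mul hHm.aestronglyMeasurable (ae_of_all _ hHb))
    (fun y _ => hHder y) (fun y _ => hφder y)
  simp only [ContinuousLinearMap.mul_apply'] at hibp
  rw [hibp, neg_neg]
  have hKρ : ∫ y, K (y j) ∂ρ = ∫ y, K (y j) * φ y ^ 2 := by
    conv_lhs => rw [hρ]
    rw [integral_withDensity_eq_integral_toReal_smul
      (hφ.continuous.measurable.pow_const 2).ennreal_ofReal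
      (ae_of_all _ fun _ => ENNReal.ofReal_lt_top)]
    refine integral_congr_ae (ae_of_all _ fun y => ?_)
    simp only [ENNReal.toReal_ofReal (sq_nonneg (φ y)), smul_eq_mul, mul_comm]
  have hfin : ∫ y, C * (K (y j) * P) * φ y ^ 2 = C * P * ∫ y, K (y j) * φ y ^ 2 := by
    rw [← integral_const_mul]
    refine integral_congr_ae (ae_of_all _ fun y => ?_)
    simp only
    ring
  rw [hfin, ← hKρ]
  change ∫ y, K (y j) ∂ρ = _ at hmass
  rw [hmass, hC]
  field_simp
  ring

/-- the key identity `-∫ H_j ∂_{y_i}(φ²) dy = δ_{ij}` coming from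
translation covariance of the regularized median. -/
theorem stmt17 (g : E3 → ℝ) (hg : IsMollifier g) (hrot : RotInv g)
    (h ℓ : ℝ) (hh : 0 < h) (hℓ : 0 < ℓ) (hadapt : Adapted g h ℓ)
    (q β d D δ R R' : ℝ)
    (hq0 : 0 < q) (hq : q < 1/2) (hβ : 0 < β) (hd : 0 < d) (hD : 0 < D) (hδ0 : 0 < δ)
    (hR : 0 < R) (hR' : 0 < R') (hδ : δ < d^2/2) (hqδ : q ≤ 1/2 - δ/d^2)
    (φ : E3 → ℝ) (hφrad : ∀ x y : E3, ‖x‖ = ‖y‖ → φ x = φ y)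
    (hφdiff : Differentiable ℝ φ)
    (hφL2 : Integrable (fun y => (φ y)^2) (volume : Measure E3))
    (hφgrad : Integrable (fun y => ‖fderiv ℝ φ y‖^2) (volume : Measure E3))
    (ρ₀ : Measure E3) [IsFiniteMeasure ρ₀]
    (hρ₀def : ρ₀ = volume.withDensity (fun y => ENNReal.ofReal ((φ y)^2)))
    (hρ₀ : ρ₀ ≠ 0)
    (z₀ : ℝ) (hz₀ : 0 < z₀)
    (hadm : ∀ z : E3, ‖z‖ ≤ z₀ →
      Admissible (convFn g g) q ℓ β d D δ R R' ρ₀ ρ₀ (ρ₀.map (fun y => y + z))) :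
    ∀ i j : Fin 3,
      (-∫ y, Hfun (convFn g g) q ρ₀ j y * fderiv ℝ (fun w => (φ w)^2) y (esingle i))
          = (if i = j then (1:ℝ) else 0) ∧
      (-(2:ℝ)) * (∫ y, (φ y * Hfun (convFn g g) q ρ₀ j y) * fderiv ℝ φ y (esingle i))
          = (if i = j then (1:ℝ) else 0) := by
  intro i j
  have hmain := neg_integral_Hfun_mul_fderiv_sq (hg.isEvenKernel_convFn hrot) hq0 hq hφdiff hφL2
    hφgrad hρ₀def hρ₀ i j
  refine ⟨?_, ?_⟩
  · rw [← hmain]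
    congr 1
    refine integral_congr_ae (ae_of_all _ fun y => ?_)
    simp only
    rw [((hφdiff y).hasFDerivAt.pow 2).fderiv]
    congr 1
    simp
    ring
  · rw [← hmain, neg_mul, ← integral_const_mul]
    congr 1
    refine integral_congr_ae (ae_of_all _ fun y => ?_)
    simp only
    ring

end
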